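/- Let h be a harmonic homogeneous polynomial of degree m in n real variables and let j ≥ 0. Then the j-fold iterated polynomial Laplacian satisfies Δ^j(q^j · h) = (Π_{i=1}^{j} 2i(n + 2m + 2i − 2)) · h, and consequently Δ^{j+1}(q^j · h) = 0, where q = Σ_{i=1}^{n} x_i². -/

import Mathlib

open MvPolynomial Finset

/-- The polynomial Laplacian `Δp = ∑ i, ∂²p/∂xᵢ²`. -/
noncomputable def polyLaplacian {n : ℕ} (p : MvPolynomial (Fin n) ℝ) :
    MvPolynomial (Fin n) ℝ :=
  ∑ i : Fin n, pderiv i (pderiv i p)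

theorem polyLaplacian_C_mul {n : ℕ} (c : ℝ) (p : MvPolynomial (Fin n) ℝ) :
    polyLaplacian (C c * p) = C c * polyLaplacian p := by
  simp [polyLaplacian, Finset.mul_sum]

theorem iterate_polyLaplacian_C_mul {n : ℕ} (c : ℝ) (k : ℕ) (p : MvPolynomial (Fin n) ℝ) :
    polyLaplacian^[k] (C c * p) = C c * polyLaplacian^[k] p :=
  have comm : Function.Commute polyLaplacian (C c * · : MvPolynomial (Fin n) ℝ → _) :=
    polyLaplacian_C_mul c
  comm.iterate_left k p

theorem pderiv_sum_X_sq {n : ℕ} (i : Fin n) :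
    pderiv i (∑ k : Fin n, X k ^ 2 : MvPolynomial (Fin n) ℝ) = 2 * X i := by
  simp [pderiv_X, Pi.single_apply]

theorem isHomogeneous_sum_X_sq (n : ℕ) :
    (∑ k : Fin n, X k ^ 2 : MvPolynomial (Fin n) ℝ).IsHomogeneous 2 :=
  IsHomogeneous.sum _ _ _ fun k _ => isHomogeneous_X_pow k 2

/-- Multiplication by `q = ∑ xᵢ²` commutes with the Laplacian up to `4 E + 2 n`, where the Euler
operator `E` acts on homogeneous polynomials of degree `d` as multiplication by `d`. -/
theorem polyLaplacian_sum_X_sq_mul {n d : ℕ} {f : MvPolynomial (Fin n) ℝ}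
    (hf : f.IsHomogeneous d) :
    polyLaplacian ((∑ k : Fin n, X k ^ 2) * f) =
      (2 * (n : MvPolynomial (Fin n) ℝ) + 4 * (d : MvPolynomial (Fin n) ℝ)) * f + (∑ k : Fin n, X k ^ 2) * polyLaplacian f := by
  have step (i : Fin n) : pderiv i (pderiv i ((∑ k : Fin n, X k ^ 2) * f)) =
      2 * f + 4 * (X i * pderiv i f) + (∑ k : Fin n, X k ^ 2) * pderiv i (pderiv i f) := by
    have two : pderiv i (2 : MvPolynomial (Fin n) ℝ) = 0 := pderiv_C (a := (2 : ℝ))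
    simp only [pderiv_mul, map_add, pderiv_sum_X_sq, pderiv_X_self, two]
    ring
  have euler := hf.sum_X_mul_pderiv
  simp only [polyLaplacian, step, Finset.sum_add_distrib, ← Finset.mul_sum, euler]
  simp only [Finset.sum_const, Finset.card_univ, Fintype.card_fin, nsmul_eq_mul]
  ring

theorem polyLaplacian_sum_X_sq_pow_succ_mul {n m : ℕ} {h : MvPolynomial (Fin n) ℝ}
    (hhom : h.IsHomogeneous m) (hharm : polyLaplacian h = 0) (k : ℕ) :
    polyLaplacian ((∑ i : Fin n, X i ^ 2) ^ (k + 1) * h) =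
      C ((2 * (k + 1) * (n + 2 * m + 2 * k) : ℕ) : ℝ) * ((∑ i : Fin n, X i ^ 2) ^ k * h) := by
  have hdeg (k : ℕ) := ((isHomogeneous_sum_X_sq n).pow k).mul hhom
  induction k with
  | zero =>
    have := polyLaplacian_sum_X_sq_mul (hdeg 0)
    simp only [pow_zero, one_mul, hharm] at this
    rw [zero_add, pow_one, this]
    simp only [map_natCast]
    push_cast
    ring
  | succ k ih =>
    rw [pow_succ', mul_assoc, polyLaplacian_sum_X_sq_mul (hdeg (k + 1)), ih]
    simp only [map_natCast]
    push_cast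
    ring

theorem iterate_polyLaplacian_sum_X_sq_pow_mul {n m : ℕ} {h : MvPolynomial (Fin n) ℝ}
    (hhom : h.IsHomogeneous m) (hharm : polyLaplacian h = 0) (j : ℕ) :
    polyLaplacian^[j] ((∑ i : Fin n, X i ^ 2) ^ j * h) =
      C ((∏ i ∈ Finset.Icc 1 j, 2 * i * (n + 2 * m + 2 * i - 2) : ℕ) : ℝ) * h := by
  induction j with
  | zero => simp
  | succ k ih =>
    have shift : n + 2 * m + 2 * (k + 1) - 2 = n + 2 * m + 2 * k := by lia
    rw [Function.iterate_succ_apply, polyLaplacian_sum_X_sq_pow_succ_mul hhom hharm,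
      iterate_polyLaplacian_C_mul, ih, Finset.prod_Icc_succ_top (Nat.le_add_left 1 k), shift,
      Nat.cast_mul (∏ i ∈ Finset.Icc 1 k, _), C_mul]
    ring

/-- If `h` is harmonic and homogeneous of degree `m`, then for `j ≥ 0`,
`Δʲ(qʲ · h) = (∏_{i=1}^{j} 2i(n + 2m + 2i - 2)) · h` and `Δ^{j+1}(qʲ · h) = 0`,
where `q = ∑ xᵢ²`. -/
theorem iterated_polyLaplacian_q_pow_mul (n m j : ℕ) (hn : 1 ≤ n)
    (h : MvPolynomial (Fin n) ℝ) (hhom : h.IsHomogeneous m)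
    (hharm : polyLaplacian h = 0) :
    polyLaplacian^[j] ((∑ i : Fin n, X i ^ 2) ^ j * h) =
      (C ((∏ i ∈ Finset.Icc 1 j, 2 * i * (n + 2 * m + 2 * i - 2) : ℕ) : ℝ)) * h ∧
    polyLaplacian^[j + 1] ((∑ i : Fin n, X i ^ 2) ^ j * h) = 0 := by
  have iter := iterate_polyLaplacian_sum_X_sq_pow_mul hhom hharm j
  refine ⟨iter, ?_⟩
  rw [Function.iterate_succ_apply', iter, polyLaplacian_C_mul, hharm, mul_zero]
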